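/- arXiv:1806.06133 — 5 statements merged into one kernel-verified Lean document; each statement's English description precedes it below -/
import Mathlib

section
/- Let ℓ ≥ 1, let I = {1,…,ℓ}, and let B = ℂ[x_{i,n} : i ∈ I, n a positive integer] be the polynomial ring in the commuting variables x_{i,n}. Let r ≥ 0 and let λ_0, λ_1, …, λ_r ∈ ℂ^ℓ with λ_r ≠ 0, and set λ_n = 0 for n > r. Define ℂ-linear operators on B: for i ∈ I and n > 0, h_i(−n) is multiplication by x_{i,n} and h_i(n)(f) = n·∂f/∂x_{i,n} + λ_n(i)·f, and h_i(0)(f) = λ_0(i)·f, where λ_n(i) denotes the i-th coordinate of λ_n. Let U⁺ be the unital subalgebra of End_ℂ(B) generated by all products h_i(m)∘h_j(n) with i, j ∈ I and m, n ∈ ℤ. Then B is a simple U⁺-module: the only ℂ-subspaces of B invariant under every operator in U⁺ are {0} and B. -/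
/-- The Fock space `B = ℂ[x_{i,n} : i ∈ {1,…,ℓ}, n ∈ ℤ_{>0}]`. -/
abbrev FockSpace (ℓ : ℕ) : Type := MvPolynomial (Fin ℓ × ℕ+) ℂ

/-- The action of the Heisenberg generator `h_i(n)` (for `n ∈ ℤ`) on the Fock space,
attached to the Whittaker data `λ = (λ_0, λ_1, …)` (where `lam n i` is the `i`-th
coordinate `λ_n(i)` of `λ_n ∈ ℂ^ℓ`):
* for `n < 0`, `h_i(n)` is multiplication by the variable `x_{i,-n}`;
* `h_i(0) f = λ_0(i)·f`;
* for `n > 0`, `h_i(n) f = n·∂f/∂x_{i,n} + λ_n(i)·f`. -/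
noncomputable def heisOp {ℓ : ℕ} (lam : ℕ → Fin ℓ → ℂ) (i : Fin ℓ) :
    ℤ → Module.End ℂ (FockSpace ℓ)
  | Int.ofNat 0 => lam 0 i • (1 : Module.End ℂ (FockSpace ℓ))
  | Int.ofNat (k + 1) =>
      (((k + 1 : ℕ) : ℂ) • (MvPolynomial.pderiv (i, (⟨k + 1, k.succ_pos⟩ : ℕ+))).toLinearMap)
        + lam (k + 1) i • (1 : Module.End ℂ (FockSpace ℓ))
  | Int.negSucc k => LinearMap.mulLeft ℂ (MvPolynomial.X (i, (⟨k + 1, k.succ_pos⟩ : ℕ+)))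

/-- `U⁺` is the unital subalgebra of `End_ℂ(B)` generated by all products
`h_i(m) ∘ h_j(n)` with `i, j ∈ {1,…,ℓ}` and `m, n ∈ ℤ`. -/
noncomputable def evenSubalg {ℓ : ℕ} (lam : ℕ → Fin ℓ → ℂ) :
    Subalgebra ℂ (Module.End ℂ (FockSpace ℓ)) :=
  Algebra.adjoin ℂ
    {f : Module.End ℂ (FockSpace ℓ) |
      ∃ (i j : Fin ℓ) (m n : ℤ), f = heisOp lam i m * heisOp lam j n}

theorem fock_totalDegree_pderiv_lt {σ : Type*} (i : σ) (p : MvPolynomial σ ℂ)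
    (h : MvPolynomial.pderiv i p ≠ 0) :
    (MvPolynomial.pderiv i p).totalDegree < p.totalDegree := by
  obtain ⟨m, hm, hmd⟩ := Finset.exists_mem_eq_sup (MvPolynomial.pderiv i p).support
    (MvPolynomial.support_nonempty.2 h) (fun s => s.sum fun _ e => e)
  have h1 : (MvPolynomial.pderiv i p).totalDegree = m.sum fun _ e => e := hmd
  rw [MvPolynomial.mem_support_iff, MvPolynomial.coeff_pderiv] at hm
  have h2 : m + Finsupp.single i 1 ∈ p.support := by
    rw [MvPolynomial.mem_support_iff]
    intro h0
    simp [h0] at hm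
  have h3 := MvPolynomial.le_totalDegree h2
  rw [Finsupp.sum_add_index' (fun _ => rfl) (fun _ _ _ => rfl), Finsupp.sum_single_index rfl] at h3
  omega

theorem fock_const_of_pderiv {σ : Type*} (p : MvPolynomial σ ℂ)
    (h : ∀ i, MvPolynomial.pderiv i p = 0) : p = MvPolynomial.C (MvPolynomial.coeff 0 p) := by
  classical
  ext m
  rw [MvPolynomial.coeff_C]
  split_ifs with hm
  · rw [hm]
  · obtain ⟨i, hi⟩ : ∃ i, m i ≠ 0 := by
      by_contra! hc
      exact hm (by ext i; simp [hc i])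
    have h1 := MvPolynomial.coeff_pderiv (i := i) p (m - Finsupp.single i 1)
    have h2 : m - Finsupp.single i 1 + Finsupp.single i 1 = m := by
      apply tsub_add_cancel_of_le
      rw [Finsupp.single_le_iff]
      omega
    rw [h i, h2, MvPolynomial.coeff_zero] at h1
    rcases mul_eq_zero.1 h1.symm with h3 | h3
    · exact h3
    · exact absurd h3 (Nat.cast_add_one_ne_zero _)

theorem fock_heisOp_neg {ℓ : ℕ} (lam : ℕ → Fin ℓ → ℂ) (i : Fin ℓ) (n : ℕ+) (f : FockSpace ℓ) :
    heisOp lam i (Int.negSucc (n.natPred)) f = MvPolynomial.X (i, n) * f := by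
  have : (⟨n.natPred + 1, n.natPred.succ_pos⟩ : ℕ+) = n := by
    exact PNat.eq n.natPred_add_one
  simp only [heisOp, LinearMap.mulLeft_apply]
  rw [this]

theorem fock_heisOp_succ {ℓ : ℕ} (lam : ℕ → Fin ℓ → ℂ) (i : Fin ℓ) (k : ℕ) (f : FockSpace ℓ) :
    heisOp lam i (Int.ofNat (k + 1)) f =
      ((k + 1 : ℕ) : ℂ) • MvPolynomial.pderiv (i, k.succPNat) f
        + lam (k + 1) i • f := rfl

theorem fock_heisOp_pos {ℓ : ℕ} (lam : ℕ → Fin ℓ → ℂ) (i : Fin ℓ) (n : ℕ+) (f : FockSpace ℓ) :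
    heisOp lam i (Int.ofNat (n.natPred + 1)) f =
      (n : ℂ) • MvPolynomial.pderiv (i, n) f + lam n i • f := by
  rw [fock_heisOp_succ, n.succPNat_natPred, n.natPred_add_one]

/-- simplicity over the full Heisenberg algebra -/
theorem fock_simple_full {ℓ : ℕ} (lam : ℕ → Fin ℓ → ℂ) (V : Submodule ℂ (FockSpace ℓ))
    (hV : ∀ i m, ∀ w ∈ V, heisOp lam i m w ∈ V) : V = ⊥ ∨ V = ⊤ := by
  by_cases hb : V = ⊥
  · exact Or.inl hb
  right
  have hX : ∀ s, ∀ w ∈ V, MvPolynomial.X s * w ∈ V := by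
    rintro ⟨i, n⟩ w hw
    rw [← fock_heisOp_neg lam]
    exact hV _ _ _ hw
  have hD : ∀ s, ∀ w ∈ V, MvPolynomial.pderiv s w ∈ V := by
    rintro ⟨i, n⟩ w hw
    have h1 := hV i (Int.ofNat (n.natPred + 1)) w hw
    rw [fock_heisOp_pos] at h1
    have h2 := (V.add_mem_iff_left (V.smul_mem (lam n i) hw)).1 h1
    exact (V.smul_mem_iff (by exact_mod_cast n.ne_zero)).1 h2
  have key : ∀ d : ℕ, ∀ p ∈ V, p ≠ 0 → p.totalDegree = d → (1 : FockSpace ℓ) ∈ V := by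
    intro d
    induction d using Nat.strong_induction_on with
    | _ d ih =>
      intro p hp hp0 hd
      by_cases hall : ∀ s, MvPolynomial.pderiv s p = 0
      · have hc := fock_const_of_pderiv p hall
        set c := MvPolynomial.coeff 0 p
        have hc0 : c ≠ 0 := by
          intro h0
          rw [h0] at hc
          exact hp0 (by simpa using hc)
        have h1 : p = c • (1 : FockSpace ℓ) := by
          rw [hc, MvPolynomial.smul_eq_C_mul, mul_one]
        rw [h1] at hp
        exact (V.smul_mem_iff hc0).1 hp
      · push Not at hall
        obtain ⟨s, hs⟩ := hall
        exact ih _ (hd ▸ fock_totalDegree_pderiv_lt s p hs) _ (hD s p hp) hs rfl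
  obtain ⟨p, hp, hp0⟩ := V.ne_bot_iff.1 hb
  have h1 := key _ p hp hp0 rfl
  rw [eq_top_iff]
  rintro q -
  induction q using MvPolynomial.induction_on with
  | C a =>
    have := V.smul_mem a h1
    rwa [MvPolynomial.smul_eq_C_mul, mul_one] at this
  | add p q hp hq => exact V.add_mem hp hq
  | mul_X p s hp =>
    rw [mul_comm]
    exact hX _ _ hp

theorem fock_heisOp_one {ℓ : ℕ} (lam : ℕ → Fin ℓ → ℂ) (i : Fin ℓ) (r : ℕ) :
    heisOp lam i (Int.ofNat r) 1 = lam r i • (1 : FockSpace ℓ) := by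
  cases r with
  | zero => rfl
  | succ k => rw [fock_heisOp_succ, MvPolynomial.pderiv_one, smul_zero, zero_add]

theorem fock_no_eigen {ℓ : ℕ} (lam : ℕ → Fin ℓ → ℂ) (i : Fin ℓ) (r : ℕ) (h : lam r i ≠ 0)
    (p : FockSpace ℓ) (hp : heisOp lam i (Int.ofNat r) p = -(lam r i • p)) : p = 0 := by
  by_contra hp0
  cases r with
  | zero =>
    simp only [heisOp, LinearMap.smul_apply, Module.End.one_apply] at hp
    have : lam 0 i • p = 0 := self_eq_neg.1 hp
    exact (smul_ne_zero h hp0) this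
  | succ k =>
    rw [fock_heisOp_succ] at hp
    set s : Fin ℓ × ℕ+ := (i, k.succPNat)
    have hk : ((k + 1 : ℕ) : ℂ) ≠ 0 := by exact_mod_cast Nat.succ_ne_zero k
    have h1 : p = (-(2 * lam (k+1) i)⁻¹ * ((k + 1 : ℕ) : ℂ)) • MvPolynomial.pderiv s p := by
      have h2 : ((k + 1 : ℕ) : ℂ) • MvPolynomial.pderiv s p = (-(2 * lam (k+1) i)) • p := by
        rw [eq_sub_of_add_eq hp]
        module
      rw [mul_smul, h2, smul_smul]
      have : -(2 * lam (k+1) i)⁻¹ * -(2 * lam (k+1) i) = 1 := by field_simp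
      rw [this, one_smul]
    have hd : MvPolynomial.pderiv s p ≠ 0 := by
      intro h0
      rw [h0, smul_zero] at h1
      exact hp0 h1
    have h3 := fock_totalDegree_pderiv_lt s p hd
    have h4 := MvPolynomial.totalDegree_smul_le (-(2 * lam (k+1) i)⁻¹ * ((k + 1 : ℕ) : ℂ))
      (MvPolynomial.pderiv s p)
    rw [← h1] at h4
    omega

/-- `B_λ` is a simple `U⁺`-module: the only `ℂ`-subspaces of `B` invariant under every
operator of `U⁺` are `{0}` and `B`. -/
theorem fock_simple_over_even_subalgebra
    (ℓ : ℕ) (hℓ : 1 ≤ ℓ) (r : ℕ) (lam : ℕ → Fin ℓ → ℂ)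
    (hr : lam r ≠ 0) (hvanish : ∀ n : ℕ, r < n → lam n = 0)
    (W : Submodule ℂ (FockSpace ℓ))
    (hW : ∀ u ∈ evenSubalg lam, ∀ w ∈ W, u w ∈ W) :
    W = ⊥ ∨ W = ⊤ := by
  by_cases hb : W = ⊥
  · exact Or.inl hb
  right
  obtain ⟨i, hi⟩ : ∃ i, lam r i ≠ 0 := by
    by_contra! hc
    exact hr (funext hc)
  have hWW : ∀ i j m n, ∀ w ∈ W, heisOp lam i m (heisOp lam j n w) ∈ W := fun i j m n w hw =>
    hW (heisOp lam i m * heisOp lam j n) (Algebra.subset_adjoin ⟨i, j, m, n, rfl⟩) w hw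
  let W' : Submodule ℂ (FockSpace ℓ) := ⨆ j, ⨆ n, W.map (heisOp lam j n)
  have hWW' : ∀ j n, ∀ w ∈ W, heisOp lam j n w ∈ W' := fun j n w hw =>
    (le_iSup_of_le j (le_iSup_of_le n le_rfl) : W.map (heisOp lam j n) ≤ W')
      (Submodule.mem_map_of_mem hw)
  have hW'W : ∀ j n, ∀ w ∈ W', heisOp lam j n w ∈ W := by
    intro j n
    have : W' ≤ W.comap (heisOp lam j n) := by
      refine iSup_le fun k => iSup_le fun m => ?_
      rw [Submodule.map_le_iff_le_comap]
      intro w hw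
      exact hWW _ _ _ _ w hw
    exact this
  rcases fock_simple_full lam (W ⊓ W') (fun j n w hw =>
    ⟨hW'W j n w hw.2, hWW' j n w hw.1⟩) with hinf | hinf
  · exfalso
    rcases fock_simple_full lam (W ⊔ W') (fun j n w hw => by
      obtain ⟨a, ha, b, hb, rfl⟩ := Submodule.mem_sup.1 hw
      rw [map_add, add_comm]
      exact Submodule.add_mem_sup (hW'W j n b hb) (hWW' j n a ha)) with hsup | hsup
    · exact hb (le_bot_iff.1 (hsup ▸ le_sup_left))
    · have h1 : (1 : FockSpace ℓ) ∈ W ⊔ W' := hsup ▸ Submodule.mem_top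
      obtain ⟨a, ha, b, hb, hab⟩ := Submodule.mem_sup.1 h1
      have h2 := fock_heisOp_one lam i r
      rw [← hab, map_add, smul_add] at h2
      set H := heisOp lam i (Int.ofNat r)
      have h3 : H a - lam r i • b = lam r i • a - H b := by
        rw [sub_eq_sub_iff_add_eq_add, h2]
      have h4 : H a - lam r i • b ∈ W ⊓ W' :=
        ⟨h3 ▸ W.sub_mem (W.smul_mem _ ha) (hW'W _ _ _ hb),
          W'.sub_mem (hWW' _ _ _ ha) (W'.smul_mem _ hb)⟩
      rw [hinf, Submodule.mem_bot] at h4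
      have h5 := h3 ▸ h4
      have h6 : a - b = 0 := by
        apply fock_no_eigen lam i r hi
        change H (a - b) = _
        rw [map_sub, sub_eq_zero.1 h4, ← sub_eq_zero.1 h5, smul_sub]
        abel
      have h7 : a ∈ W ⊓ W' := ⟨ha, (sub_eq_zero.1 h6) ▸ hb⟩
      rw [hinf, Submodule.mem_bot] at h7
      rw [← sub_eq_zero.1 h6, h7, add_zero] at hab
      exact zero_ne_one hab
  · exact top_le_iff.1 (hinf ▸ inf_le_left)
end

section
/- Let ℓ ≥ 1, let I = {1,…,ℓ}, and let B = ℂ[x_{i,n} : i ∈ I, n ∈ ½ + ℕ] be the polynomial ring in commuting variables indexed by pairs (i,n) with i ∈ I and n a positive half-odd-integer (n ∈ {1/2, 3/2, 5/2, …}). Let r ≥ 0 and let λ_{1/2}, λ_{3/2}, …, λ_{r+1/2} ∈ ℂ^ℓ with λ_{r+1/2} ≠ 0, and set λ_n = 0 for half-odd-integers n > r + 1/2. Define ℂ-linear operators on B: for i ∈ I and n ∈ {1/2, 3/2, …}, h_i(−n) is multiplication by x_{i,n} and h_i(n)(f) = n·∂f/∂x_{i,n} + λ_n(i)·f, where λ_n(i)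 is the i-th coordinate of λ_n. Let U⁺ be the unital subalgebra of End_ℂ(B) generated by all products h_i(m)∘h_j(n) with i, j ∈ I and m, n ∈ ½ + ℤ. Then B is a simple U⁺-module: the only ℂ-subspaces of B invariant under every operator in U⁺ are {0} and B. -/
/-- The twisted Fock space `B = ℂ[x_{i,n} : i ∈ {1,…,ℓ}, n ∈ ½+ℕ]`: the variable
`x_{i, k+1/2}` is encoded by the index `(i, k)` with `k ∈ ℕ`. -/
abbrev TwFockSpace (ℓ : ℕ) : Type := MvPolynomial (Fin ℓ × ℕ) ℂ

/-- The action of the twisted Heisenberg generator `h_i(n)` for `n ∈ ½+ℤ` on the twisted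
Fock space, attached to the Whittaker data `λ = (λ_{1/2}, λ_{3/2}, …)`.  The half-odd
integer `n = t + 1/2` is encoded by `t : ℤ`, and `lam k i` denotes the `i`-th coordinate
`λ_{k+1/2}(i)` of `λ_{k+1/2} ∈ ℂ^ℓ`:
* for `t = -(k+1) < 0`, i.e. `n = -(k + 1/2) < 0`, `h_i(n)` is multiplication by the
  variable `x_{i,k+1/2}`;
* for `t = k ≥ 0`, i.e. `n = k + 1/2 > 0`, `h_i(n) f = n·∂f/∂x_{i,n} + λ_n(i)·f`. -/
noncomputable def twHeisOp {ℓ : ℕ} (lam : ℕ → Fin ℓ → ℂ) (i : Fin ℓ) :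
    ℤ → Module.End ℂ (TwFockSpace ℓ)
  | Int.ofNat k =>
      (((k : ℂ) + 1/2) • (MvPolynomial.pderiv (i, k)).toLinearMap)
        + lam k i • (1 : Module.End ℂ (TwFockSpace ℓ))
  | Int.negSucc k => LinearMap.mulLeft ℂ (MvPolynomial.X (i, k))

/-- `U⁺` is the unital subalgebra of `End_ℂ(B)` generated by all products
`h_i(m) ∘ h_j(n)` with `i, j ∈ {1,…,ℓ}` and `m, n ∈ ½+ℤ`. -/
noncomputable def twEvenSubalg {ℓ : ℕ} (lam : ℕ → Fin ℓ → ℂ) :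
    Subalgebra ℂ (Module.End ℂ (TwFockSpace ℓ)) :=
  Algebra.adjoin ℂ
    {f : Module.End ℂ (TwFockSpace ℓ) |
      ∃ (i j : Fin ℓ) (m n : ℤ), f = twHeisOp lam i m * twHeisOp lam j n}


theorem twAux_degree_pderiv_lt {σ : Type*} (i : σ) (f : MvPolynomial σ ℂ)
    (h : MvPolynomial.pderiv i f ≠ 0) :
    (MvPolynomial.pderiv i f).totalDegree < f.totalDegree := by
  classical
  have key : ∀ m ∈ (MvPolynomial.pderiv i f).support,
      (m.sum fun _ e => e) + 1 ≤ f.totalDegree := by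
    intro m hm
    rw [MvPolynomial.mem_support_iff, MvPolynomial.coeff_pderiv] at hm
    have h1 := MvPolynomial.le_totalDegree (p := f) (s := m + Finsupp.single i 1)
      (MvPolynomial.mem_support_iff.2 (left_ne_zero_of_mul hm))
    rw [Finsupp.sum_add_index' (by simp) (by simp)] at h1
    simpa using h1
  obtain ⟨m, hm⟩ := MvPolynomial.support_nonempty.2 h
  have h0 := key m hm
  rw [MvPolynomial.totalDegree, Finset.sup_lt_iff (by rw [bot_eq_zero]; omega)]
  intro m hm
  have := key m hm
  omega

theorem twAux_pderiv_eigen {σ : Type*} (i : σ) (f : MvPolynomial σ ℂ) (c : ℂ) (hc : c ≠ 0)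
    (h : MvPolynomial.pderiv i f = c • f) : f = 0 := by
  by_contra hf
  have h1 := twAux_degree_pderiv_lt i f (by rw [h]; exact smul_ne_zero hc hf)
  have h2 : f.totalDegree ≤ (MvPolynomial.pderiv i f).totalDegree := by
    have : f = c⁻¹ • MvPolynomial.pderiv i f := by rw [h, smul_smul, inv_mul_cancel₀ hc, one_smul]
    conv_lhs => rw [this]
    exact MvPolynomial.totalDegree_smul_le _ _
  omega

theorem twAux_const {σ : Type*} (f : MvPolynomial σ ℂ)
    (h : ∀ i, MvPolynomial.pderiv i f = 0) : f = MvPolynomial.C (MvPolynomial.coeff 0 f) := by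
  classical
  ext m
  rw [MvPolynomial.coeff_C]
  split_ifs with hm
  · rw [hm]
  · obtain ⟨i, hi⟩ : ∃ i, m i ≠ 0 := by
      by_contra! hcon
      exact hm (by ext i; simp [hcon i])
    have h1 := MvPolynomial.coeff_pderiv (i := i) f (m - Finsupp.single i 1)
    have h2 : m - Finsupp.single i 1 + Finsupp.single i 1 = m :=
      tsub_add_cancel_of_le (by simpa [Finsupp.single_le_iff] using Nat.one_le_iff_ne_zero.2 hi)
    rw [h i, h2, MvPolynomial.coeff_zero] at h1
    refine (mul_eq_zero.1 h1.symm).resolve_right ?_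
    exact Nat.cast_add_one_ne_zero _

theorem twAux_weyl_simple {σ : Type*} (V : Submodule ℂ (MvPolynomial σ ℂ))
    (hX : ∀ i, ∀ f ∈ V, MvPolynomial.X i * f ∈ V)
    (hD : ∀ i, ∀ f ∈ V, MvPolynomial.pderiv i f ∈ V) (hV : V ≠ ⊥) : V = ⊤ := by
  have step : ∀ n : ℕ, ∀ f ∈ V, f ≠ 0 → f.totalDegree = n → (1 : MvPolynomial σ ℂ) ∈ V := by
    intro n
    induction n using Nat.strong_induction_on with
    | _ n ih =>
      intro f hf hf0 hn
      by_cases h : ∀ i, MvPolynomial.pderiv i f = 0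
      · have h1 := twAux_const f h
        have h2 : MvPolynomial.coeff 0 f ≠ 0 := by
          intro h3
          rw [h3, map_zero] at h1
          exact hf0 h1
        have h4 := V.smul_mem (MvPolynomial.coeff 0 f)⁻¹ hf
        rw [h1, MvPolynomial.smul_eq_C_mul, ← map_mul] at h4
        simpa [h2] using h4
      · push Not at h
        obtain ⟨i, hi⟩ := h
        exact ih _ (hn ▸ twAux_degree_pderiv_lt i f hi) _ (hD i f hf) hi rfl
  obtain ⟨f, hf, hf0⟩ := V.ne_bot_iff.1 hV
  have h1 := step _ f hf hf0 rfl
  rw [eq_top_iff]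
  rintro p -
  induction p using MvPolynomial.induction_on with
  | C a =>
    have := V.smul_mem a h1
    rwa [MvPolynomial.smul_eq_C_mul, mul_one] at this
  | add p q hp hq => exact V.add_mem hp hq
  | mul_X p i hp => rw [mul_comm]; exact hX i p hp

theorem twAux_fock_simple {ℓ : ℕ} (lam : ℕ → Fin ℓ → ℂ) (V : Submodule ℂ (TwFockSpace ℓ))
    (h : ∀ i t, ∀ f ∈ V, twHeisOp lam i t f ∈ V) (hV : V ≠ ⊥) : V = ⊤ := by
  refine twAux_weyl_simple V ?_ ?_ hV
  · rintro ⟨i, k⟩ f hf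
    exact h i (Int.negSucc k) f hf
  · rintro ⟨i, k⟩ f hf
    have h1 := h i (Int.ofNat k) f hf
    have hk : (k : ℂ) + 1/2 ≠ 0 := by
      intro h0
      have := congrArg Complex.re h0
      simp at this
      have h3 : (0 : ℝ) ≤ k := Nat.cast_nonneg k
      linarith
    have h2 := V.smul_mem ((k : ℂ) + 1/2)⁻¹ (V.sub_mem h1 (V.smul_mem (lam k i) hf))
    simp only [twHeisOp, LinearMap.add_apply, LinearMap.smul_apply, Module.End.one_apply,
      add_sub_cancel_right, smul_smul, inv_mul_cancel₀ hk, one_smul] at h2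
    exact h2

theorem twAux_op_nonneg {ℓ : ℕ} (lam : ℕ → Fin ℓ → ℂ) (i : Fin ℓ) (k : ℕ)
    (f : TwFockSpace ℓ) : twHeisOp lam i (Int.ofNat k) f
      = ((k : ℂ) + 1/2) • MvPolynomial.pderiv (i, k) f + lam k i • f := by
  simp only [twHeisOp, LinearMap.add_apply, LinearMap.smul_apply, Module.End.one_apply]
  rfl

theorem twAux_no_sign {ℓ : ℕ} (lam : ℕ → Fin ℓ → ℂ) (i : Fin ℓ) (r : ℕ)
    (hi : lam r i ≠ 0) (g : TwFockSpace ℓ)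
    (hg : twHeisOp lam i (Int.ofNat r) g = - (lam r i • g)) : g = 0 := by
  have hk : (r : ℂ) + 1/2 ≠ 0 := by
    intro h0
    have := congrArg Complex.re h0
    simp at this
    have h3 : (0 : ℝ) ≤ r := Nat.cast_nonneg r
    linarith
  rw [twAux_op_nonneg] at hg
  have h2 : ((r : ℂ) + 1/2) • MvPolynomial.pderiv (i, r) g = (-2 * lam r i) • g := by
    rw [eq_sub_of_add_eq hg, neg_mul, two_mul, neg_smul, add_smul, neg_add, sub_eq_add_neg]
  have hC : MvPolynomial.pderiv (i, r) g = (((r : ℂ) + 1/2)⁻¹ * (-2 * lam r i)) • g := by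
    rw [mul_smul, ← h2, smul_smul, inv_mul_cancel₀ hk, one_smul]
  exact twAux_pderiv_eigen (i, r) g _
    (mul_ne_zero (inv_ne_zero hk) (mul_ne_zero (by norm_num) hi)) hC

theorem twAux_abstract {M P : Type*} [AddCommGroup M] [Module ℂ M] (T : P → Module.End ℂ M)
    (hsimple : ∀ V : Submodule ℂ M, (∀ t, ∀ f ∈ V, T t f ∈ V) → V ≠ ⊥ → V = ⊤)
    (e : M) (he : e ≠ 0) (p0 : P) (c : ℂ) (hT1 : T p0 e = c • e)
    (hsign : ∀ g, T p0 g = - (c • g) → g = 0) (W : Submodule ℂ M) (hW0 : W ≠ ⊥)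
    (hWW : ∀ s t, ∀ w ∈ W, T s (T t w) ∈ W) : W = ⊤ := by
  -- the odd companion of `W`
  let O : Submodule ℂ (M) := ⨆ p : P, W.map (T p)
  have hWO : ∀ t, ∀ f ∈ W, T t f ∈ O := by
    intro t f hf
    exact (le_iSup (fun p : P => W.map (T p)) t)
      (Submodule.mem_map_of_mem hf)
  have hOW : ∀ t, ∀ f ∈ O, T t f ∈ W := by
    intro t f hf
    have : O ≤ W.comap (T t) := by
      refine iSup_le ?_
      intro s
      rintro _ ⟨w, hw, rfl⟩
      exact hWW t s w hw
    exact this hf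
  by_cases hinf : W ⊓ O = ⊥
  · exfalso
    have hsup : W ⊔ O = ⊤ := by
      refine hsimple _ ?_ ?_
      · intro t f hf
        obtain ⟨a, ha, b, hb, rfl⟩ := Submodule.mem_sup.1 hf
        rw [map_add, add_comm]
        exact Submodule.add_mem_sup (hOW t b hb) (hWO t a ha)
      · intro h
        exact hW0 (le_bot_iff.1 (h ▸ le_sup_left))
    obtain ⟨w, hw, v, hv, hwv⟩ := Submodule.mem_sup.1
      (show e ∈ W ⊔ O by rw [hsup]; trivial)
    rw [← hwv, map_add, smul_add] at hT1
    have hA : T p0 w - c • v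
        = c • w - T p0 v := by
      rw [sub_eq_sub_iff_add_eq_add, hT1]
    have hz : T p0 w - c • v ∈ W ⊓ O := by
      refine ⟨?_, O.sub_mem (hWO _ _ hw) (O.smul_mem _ hv)⟩
      rw [hA]
      exact W.sub_mem (W.smul_mem _ hw) (hOW _ _ hv)
    rw [hinf, Submodule.mem_bot] at hz
    have hz2 := hA.symm.trans hz
    have hB : T p0 (w - v) = - (c • (w - v)) := by
      rw [map_sub, sub_eq_zero.1 hz, ← sub_eq_zero.1 hz2, smul_sub, neg_sub]
    have hD := hsign (w - v) hB
    have hwv' : w = v := sub_eq_zero.1 hD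
    have hw0 : w ∈ W ⊓ O := ⟨hw, hwv' ▸ hv⟩
    rw [hinf, Submodule.mem_bot] at hw0
    rw [← hwv', hw0, add_zero] at hwv
    exact he hwv.symm
  · have htop : W ⊓ O = ⊤ := by
      refine hsimple _ ?_ hinf
      intro t f hf
      exact ⟨hOW t f hf.2, hWO t f hf.1⟩
    exact top_le_iff.1 (htop ▸ inf_le_left)

/-- `B_λ^θ` is a simple `U⁺`-module: the only `ℂ`-subspaces of `B` invariant under every
operator of `U⁺` are `{0}` and `B`.  Here `lam k` encodes `λ_{k+1/2} ∈ ℂ^ℓ`, with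
`λ_{r+1/2} ≠ 0` and `λ_n = 0` for half-odd integers `n > r + 1/2`. -/
theorem twisted_fock_simple_over_even_subalgebra
    (ℓ : ℕ) (hℓ : 1 ≤ ℓ) (r : ℕ) (lam : ℕ → Fin ℓ → ℂ)
    (hr : lam r ≠ 0) (hvanish : ∀ n : ℕ, r < n → lam n = 0)
    (W : Submodule ℂ (TwFockSpace ℓ))
    (hW : ∀ u ∈ twEvenSubalg lam, ∀ w ∈ W, u w ∈ W) :
    W = ⊥ ∨ W = ⊤ := by
  classical
  by_cases hW0 : W = ⊥
  · exact Or.inl hW0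
  right
  obtain ⟨i, hi⟩ := Function.ne_iff.1 hr
  refine twAux_abstract (fun p : Fin ℓ × ℤ => twHeisOp lam p.1 p.2) ?_ 1 one_ne_zero
    (i, Int.ofNat r) (lam r i) ?_ ?_ W hW0 ?_
  · intro V hV hV0
    exact twAux_fock_simple lam V (fun i t => hV (i, t)) hV0
  · show twHeisOp lam i (Int.ofNat r) 1 = _
    rw [twAux_op_nonneg, MvPolynomial.pderiv_one, smul_zero, zero_add]
  · exact twAux_no_sign lam i r hi
  · intro s t w hw
    exact hW (twHeisOp lam s.1 s.2 * twHeisOp lam t.1 t.2)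
      (Algebra.subset_adjoin ⟨s.1, t.1, s.2, t.2, rfl⟩) w hw
end

section
/- Let ℓ ≥ 1, let I = {1,…,ℓ}, and let B = ℂ[x_{i,n} : i ∈ I, n a positive integer] be graded by the weighted degree with deg x_{i,n} = n. Let λ : ℤ_{>0} → ℂ^ℓ be such that λ_n ≠ 0 for at least one positive integer n. For i ∈ I and a positive integer m write ∂_{i,m}(f) = m·∂f/∂x_{i,m}. Then for every nonzero a ∈ B that is weighted-homogeneous of positive weighted degree d, there exist i, j ∈ I and positive integers m, n such that the polynomial b = λ_m(i)·∂_{j,n}(a) + λ_n(j)·∂_{i,m}(a) + ∂_{i,m}(∂_{j,n}(a)) is nonzero and has weighted total degree strictly less than d. -/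
/-- The weight function on the variables of `B = ℂ[x_{i,n} : i ∈ {1,…,ℓ}, n ∈ ℤ_{>0}]`,
assigning `deg x_{i,n} = n`. -/
def fockWeight (ℓ : ℕ) : Fin ℓ × ℕ+ → ℕ := fun p => (p.2 : ℕ)

/-- The operator `∂_{i,m}(f) = m·∂f/∂x_{i,m}` on `B`. -/
noncomputable def fockDeriv {ℓ : ℕ} (i : Fin ℓ) (m : ℕ+)
    (f : MvPolynomial (Fin ℓ × ℕ+) ℂ) : MvPolynomial (Fin ℓ × ℕ+) ℂ :=
  ((m : ℕ) : ℂ) • MvPolynomial.pderiv (i, m) f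

open MvPolynomial in
lemma coeff_fockDeriv_aux {ℓ : ℕ} (i : Fin ℓ) (m : ℕ+)
    (f : MvPolynomial (Fin ℓ × ℕ+) ℂ) (μ : Fin ℓ × ℕ+ →₀ ℕ) :
    coeff μ (fockDeriv i m f) =
      ((m : ℕ) : ℂ) * (coeff (μ + Finsupp.single (i, m) 1) f * (μ (i, m) + 1)) := by
  simp [fockDeriv, coeff_smul, coeff_pderiv]

lemma weight_add_single_aux {ℓ : ℕ} (i : Fin ℓ) (m : ℕ+) (μ : Fin ℓ × ℕ+ →₀ ℕ) :
    Finsupp.weight (fockWeight ℓ) (μ + Finsupp.single (i, m) 1)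
      = Finsupp.weight (fockWeight ℓ) μ + (m : ℕ) := by
  simp [Finsupp.weight_single, fockWeight]

open MvPolynomial in
lemma degree_lt_aux {ℓ : ℕ} (lam : ℕ+ → Fin ℓ → ℂ)
    (a : MvPolynomial (Fin ℓ × ℕ+) ℂ) (d : ℕ) (hd : 0 < d)
    (hhom : a.IsWeightedHomogeneous (fockWeight ℓ) d) (i j : Fin ℓ) (m n : ℕ+) :
    MvPolynomial.weightedTotalDegree (fockWeight ℓ)
        (lam m i • fockDeriv j n a + lam n j • fockDeriv i m a
          + fockDeriv i m (fockDeriv j n a)) < d := by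
  have hm := m.pos
  have hn := n.pos
  unfold weightedTotalDegree
  rw [Finset.sup_lt_iff (by simpa using hd)]
  intro μ hμ
  rw [mem_support_iff] at hμ
  by_contra hlt
  apply hμ
  have key : ∀ ν, Finsupp.weight (fockWeight ℓ) ν > d → coeff ν a = 0 := by
    intro ν hν
    by_contra h
    have := hhom h
    omega
  simp only [coeff_add, coeff_smul, coeff_fockDeriv_aux]
  rw [key (μ + Finsupp.single (j, n) 1) (by rw [weight_add_single_aux]; omega),
    key (μ + Finsupp.single (i, m) 1) (by rw [weight_add_single_aux]; omega),
    key (μ + Finsupp.single (i, m) 1 + Finsupp.single (j, n) 1)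
      (by rw [weight_add_single_aux, weight_add_single_aux]; omega)]
  simp

/-- Key induction step: if some `λ_n ≠ 0`, then for every nonzero weighted-homogeneous
`a ∈ B` of positive weighted degree `d` there are `i, j ∈ {1,…,ℓ}` and positive integers
`m, n` such that `b = λ_m(i)·∂_{j,n}(a) + λ_n(j)·∂_{i,m}(a) + ∂_{i,m}(∂_{j,n}(a))` is
nonzero of weighted total degree strictly less than `d`. -/
theorem exists_lowering_operator_nonzero
    (ℓ : ℕ) (hℓ : 1 ≤ ℓ) (lam : ℕ+ → Fin ℓ → ℂ) (hlam : ∃ n : ℕ+, lam n ≠ 0)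
    (a : MvPolynomial (Fin ℓ × ℕ+) ℂ) (ha : a ≠ 0) (d : ℕ) (hd : 0 < d)
    (hhom : a.IsWeightedHomogeneous (fockWeight ℓ) d) :
    ∃ (i j : Fin ℓ) (m n : ℕ+),
      lam m i • fockDeriv j n a + lam n j • fockDeriv i m a
          + fockDeriv i m (fockDeriv j n a) ≠ 0 ∧
      MvPolynomial.weightedTotalDegree (fockWeight ℓ)
        (lam m i • fockDeriv j n a + lam n j • fockDeriv i m a
          + fockDeriv i m (fockDeriv j n a)) < d := by

  obtain ⟨n, hn⟩ := hlam
  obtain ⟨j, hj⟩ := Function.ne_iff.mp hn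
  simp only [Pi.zero_apply] at hj
  by_cases hs : fockDeriv j n a = 0
  · obtain ⟨μ, hμ⟩ := MvPolynomial.ne_zero_iff.mp ha
    have hμ0 : μ ≠ 0 := by
      rintro rfl
      have := hhom hμ
      simp at this
      omega
    obtain ⟨⟨i, m⟩, hp⟩ := Finsupp.ne_iff.mp hμ0
    refine ⟨i, j, m, n, ?_, degree_lt_aux lam a d hd hhom i j m n⟩
    have hz : fockDeriv i m (0 : MvPolynomial (Fin ℓ × ℕ+) ℂ) = 0 := by simp [fockDeriv]
    rw [hs, hz, smul_zero, zero_add, add_zero]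
    refine smul_ne_zero hj ?_
    intro h0
    have hc := coeff_fockDeriv_aux i m a (μ - Finsupp.single (i, m) 1)
    rw [h0, Finsupp.sub_add_single_one_cancel hp, MvPolynomial.coeff_zero] at hc
    refine mul_ne_zero ?_ (mul_ne_zero hμ ?_) hc.symm
    · exact_mod_cast m.pos.ne'
    · exact Nat.cast_add_one_ne_zero _
  · refine ⟨j, j, n, n, ?_, degree_lt_aux lam a d hd hhom j j n n⟩
    obtain ⟨μ, hμ⟩ := MvPolynomial.ne_zero_iff.mp hs
    intro h0
    have hc := congrArg (MvPolynomial.coeff μ) h0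
    have h1 : MvPolynomial.coeff (μ + Finsupp.single (j, n) 1) a ≠ 0 := by
      intro h
      apply hμ
      rw [coeff_fockDeriv_aux, h]
      simp
    have hw := hhom h1
    have h2 : MvPolynomial.coeff μ (fockDeriv j n (fockDeriv j n a)) = 0 := by
      have h3 : MvPolynomial.coeff
          (μ + Finsupp.single (j, n) 1 + Finsupp.single (j, n) 1) a = 0 := by
        by_contra h
        have hw2 := hhom h
        rw [weight_add_single_aux] at hw2
        have := n.pos
        omega
      rw [coeff_fockDeriv_aux, coeff_fockDeriv_aux, h3]
      simp
    rw [MvPolynomial.coeff_add, MvPolynomial.coeff_add, h2, MvPolynomial.coeff_smul,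
      MvPolynomial.coeff_zero, add_zero, smul_eq_mul, ← two_mul] at hc
    exact mul_ne_zero two_ne_zero (mul_ne_zero hj hμ) hc
end

section
/- Let ℓ ≥ 1 and let r ≥ 0. For v, w ∈ ℂ^ℓ write (v,w) = Σ_{i=1}^ℓ v_i·w_i for the standard symmetric bilinear form, and let S^{ℓ−1}_ℂ = {z ∈ ℂ^ℓ : z_1² + z_2² + ⋯ + z_ℓ² = 1}. Fix (ζ_{r+1}, …, ζ_{2r+1}) ∈ ℂ^r × ℂ^× with ζ_{2r+1} ≠ 0. Then the set of tuples (λ_0, λ_1, …, λ_r) ∈ (ℂ^ℓ)^r × (ℂ^ℓ ∖ {0}) satisfying ζ_i = ½·Σ_{0 ≤ m,n ≤ r, m+n = i−1} (λ_m, λ_n) for all i = r+1, …, 2r+1 is in bijection with S^{ℓ−1}_ℂ × ℂ^{(ℓ−1)·r}. -/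
open Finset

/-- A triangular system has exactly one solution. -/
theorem triangular_existsUnique {V : Type*} (v0 : V) : ∀ (r : ℕ) (F : Fin r → (Fin r → V) → V)
    (_ : ∀ k x y, (∀ j, k < j → x j = y j) → F k x = F k y),
    ∃! x : Fin r → V, ∀ k, x k = F k x := by
  intro r
  induction r with
  | zero =>
    intro F _
    exact ⟨fun k => k.elim0, fun k => k.elim0, fun y _ => funext fun k => k.elim0⟩
  | succ r ih =>
    intro F hF
    have key : ∀ (k : Fin (r + 1)) (v w : V) (x : Fin r → V),
        F k (Fin.cons v x) = F k (Fin.cons w x) := by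
      intro k v w x
      apply hF
      intro j hj
      have hj0 : j ≠ 0 := by
        rintro rfl
        exact absurd hj (Fin.not_lt_zero k)
      obtain ⟨i, rfl⟩ := Fin.exists_succ_eq.2 hj0
      simp
    obtain ⟨x, hx, hu⟩ := ih (fun k x => F k.succ (Fin.cons v0 x)) (by
      intro k x y hxy
      apply hF
      intro j hj
      refine Fin.cases ?_ (fun i hi => ?_) j hj
      · intro h
        simp
      · simpa using hxy i (by simpa using hi))
    refine ⟨Fin.cons (F 0 (Fin.cons v0 x)) x, ?_, ?_⟩
    · intro k
      rw [key k _ v0 x]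
      refine Fin.cases ?_ (fun i => ?_) k
      · simp
      · simpa using hx i
    · intro y hy
      rw [← Fin.cons_self_tail y] at hy ⊢
      have ht : Fin.tail y = x := by
        apply hu
        intro k
        have := hy k.succ
        rw [key _ _ v0] at this
        simpa using this
      have h0 := hy 0
      rw [key _ _ v0, ht] at h0
      rw [ht]
      simp only [Fin.cons_zero] at h0
      rw [h0]

open Matrix in
/-- Coordinates adapted to a vector of the complex sphere. -/
theorem exists_adapted_equiv (ℓ : ℕ) (z : Fin ℓ → ℂ) (hz : z ⬝ᵥ z = 1) :
    ∃ e : (Fin ℓ → ℂ) ≃ ℂ × (Fin (ℓ - 1) → ℂ), ∀ v, (e v).1 = z ⬝ᵥ v := by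
  let φ : (Fin ℓ → ℂ) →ₗ[ℂ] ℂ := dotProductBilin ℂ ℂ z
  have hφ : ∀ v, φ v = z ⬝ᵥ v := fun v => rfl
  have hne : φ ≠ 0 := by
    intro h
    have := hφ z
    rw [h, hz] at this
    simp at this
  have hd : Module.finrank ℂ (LinearMap.ker φ) = Module.finrank ℂ (Fin (ℓ - 1) → ℂ) := by
    have := Module.Dual.finrank_ker_add_one_of_ne_zero (f := φ) hne
    simp at this ⊢
    omega
  let g := LinearEquiv.ofFinrankEq _ _ hd
  let e1 : (Fin ℓ → ℂ) ≃ ℂ × LinearMap.ker φ :=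
    { toFun := fun v => (φ v, ⟨v - φ v • z, by
        rw [LinearMap.mem_ker, map_sub, map_smul, hφ z, hz]; simp⟩)
      invFun := fun p => p.1 • z + p.2
      left_inv := fun v => by simp
      right_inv := fun p => by
        obtain ⟨t, k, hk⟩ := p
        rw [LinearMap.mem_ker] at hk
        have h : φ (t • z + k) = t := by
          rw [map_add, map_smul, hk, hφ z, hz]; simp
        ext1
        · exact h
        · apply Subtype.ext
          simp only [h]
          simp }
  exact ⟨e1.trans (Equiv.prodCongr (Equiv.refl _) g.toEquiv), fun v => rfl⟩

open Matrix in
/-- The right-hand side of the triangular system. -/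
noncomputable def fiberRhs {ℓ r : ℕ} (ζ : Fin (r + 1) → ℂ) (k : Fin r) (x : Fin r → Fin ℓ → ℂ) :
    ℂ :=
  ζ k.castSucc - (1 / 2 : ℂ) * ∑ m : Fin r, ∑ n : Fin r,
    if (m : ℕ) + (n : ℕ) = r + (k : ℕ) then x m ⬝ᵥ x n else 0

open Matrix in
theorem fiber_iff {ℓ r : ℕ} (ζ : Fin (r + 1) → ℂ) (hζ : ζ (Fin.last r) ≠ 0)
    (lam : Fin (r + 1) → Fin ℓ → ℂ) :
    (lam (Fin.last r) ≠ 0 ∧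
        ∀ k : Fin (r + 1),
          ζ k = (1 / 2 : ℂ) * ∑ p ∈ univ.filter
              (fun p : Fin (r + 1) × Fin (r + 1) => (p.1 : ℕ) + (p.2 : ℕ) = r + (k : ℕ)),
              ∑ i, lam p.1 i * lam p.2 i) ↔
    (lam (Fin.last r) ⬝ᵥ lam (Fin.last r) = 2 * ζ (Fin.last r) ∧
      ∀ k : Fin r, lam (Fin.last r) ⬝ᵥ lam k.castSucc =
        fiberRhs ζ k (fun j => lam j.castSucc)) := by
  have hS : ∀ k : Fin (r + 1), ∑ p ∈ univ.filter
              (fun p : Fin (r + 1) × Fin (r + 1) => (p.1 : ℕ) + (p.2 : ℕ) = r + (k : ℕ)),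
              ∑ i, lam p.1 i * lam p.2 i = ∑ m : Fin (r + 1), ∑ n : Fin (r + 1),
              if (m : ℕ) + (n : ℕ) = r + (k : ℕ) then lam m ⬝ᵥ lam n else 0 := by
    intro k
    rw [Finset.sum_filter, Fintype.sum_prod_type]
    rfl
  simp only [hS]
  have hlast : (∑ m : Fin (r + 1), ∑ n : Fin (r + 1),
      if (m : ℕ) + (n : ℕ) = r + ((Fin.last r : Fin (r + 1)) : ℕ) then lam m ⬝ᵥ lam n else 0)
      = lam (Fin.last r) ⬝ᵥ lam (Fin.last r) := by
    have h1 : ∀ m n : Fin (r + 1), ((m : ℕ) + (n : ℕ) = r + ((Fin.last r : Fin (r + 1)) : ℕ)) ↔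
        (m = Fin.last r ∧ n = Fin.last r) := by
      intro m n
      simp only [Fin.ext_iff, Fin.val_last]
      omega
    simp only [h1, ite_and]
    simp
  have hk : ∀ k : Fin r, (∑ m : Fin (r + 1), ∑ n : Fin (r + 1),
      if (m : ℕ) + (n : ℕ) = r + ((k.castSucc : Fin (r + 1)) : ℕ) then lam m ⬝ᵥ lam n else 0)
      = 2 * (lam (Fin.last r) ⬝ᵥ lam k.castSucc) + ∑ m : Fin r, ∑ n : Fin r,
        if (m : ℕ) + (n : ℕ) = r + (k : ℕ) then lam m.castSucc ⬝ᵥ lam n.castSucc else 0 := by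
    intro k
    have h1 : ∀ m : Fin r, ((m : ℕ) + r = r + (k : ℕ)) ↔ m = k := by
      intro m
      rw [Fin.ext_iff]; omega
    have h2 : ∀ m : Fin r, (r + (m : ℕ) = r + (k : ℕ)) ↔ m = k := by
      intro m
      rw [Fin.ext_iff]; omega
    have h3 : ¬ (r + r = r + (k : ℕ)) := by omega
    simp only [Fin.sum_univ_castSucc, Fin.val_castSucc, Fin.val_last, h1, h2, h3, if_false,
      Finset.sum_add_distrib, Finset.sum_ite_eq', Finset.mem_univ, if_true]
    rw [dotProduct_comm (lam k.castSucc)]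
    ring
  rw [Fin.forall_fin_succ']
  simp only [hlast, hk, fiberRhs]
  constructor
  · rintro ⟨_, h1, h2⟩
    refine ⟨by rw [h2]; ring, fun k => ?_⟩
    rw [h1 k]; ring
  · rintro ⟨h2, h1⟩
    refine ⟨?_, fun k => ?_, by rw [h2]; ring⟩
    · intro h0
      rw [h0] at h2
      simp at h2
      exact hζ h2
    · rw [h1 k]; ring

theorem fiberRhs_congr {ℓ r : ℕ} (ζ : Fin (r + 1) → ℂ) (k : Fin r) (x y : Fin r → Fin ℓ → ℂ)
    (h : ∀ j, k < j → x j = y j) : fiberRhs ζ k x = fiberRhs ζ k y := by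
  unfold fiberRhs
  congr 2
  refine Finset.sum_congr rfl fun m _ => Finset.sum_congr rfl fun n _ => ?_
  split_ifs with hmn
  · rw [h m (by rw [Fin.lt_def]; omega), h n (by rw [Fin.lt_def]; omega)]
  · rfl

/-- The fiber of the Whittaker-type map `Φ` over a fixed type
`ζ = (ζ_{r+1}, …, ζ_{2r+1}) ∈ ℂ^r × ℂ^×` is in bijection with
`S^{ℓ-1}_ℂ × ℂ^{(ℓ-1)·r}`, where `S^{ℓ-1}_ℂ = {z ∈ ℂ^ℓ : z_1² + ⋯ + z_ℓ² = 1}`.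
Here `lam : Fin (r+1) → Fin ℓ → ℂ` encodes `(λ_0, …, λ_r)`, `ζ : Fin (r+1) → ℂ`
encodes `(ζ_{r+1}, …, ζ_{2r+1})` (so `ζ_{2r+1} = ζ (Fin.last r) ≠ 0`), and the fiber
condition is `ζ_{r+1+k} = ½ ∑_{0 ≤ m,n ≤ r, m+n = r+k} (λ_m, λ_n)` with `λ_r ≠ 0`. -/
theorem whittakerTypeMap_fiber_equiv (ℓ r : ℕ) (hℓ : 1 ≤ ℓ)
    (ζ : Fin (r + 1) → ℂ) (hζ : ζ (Fin.last r) ≠ 0) :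
    Nonempty (
      {lam : Fin (r + 1) → Fin ℓ → ℂ // lam (Fin.last r) ≠ 0 ∧
        ∀ k : Fin (r + 1),
          ζ k = (1 / 2 : ℂ) * ∑ p ∈ univ.filter
              (fun p : Fin (r + 1) × Fin (r + 1) => (p.1 : ℕ) + (p.2 : ℕ) = r + (k : ℕ)),
              ∑ i, lam p.1 i * lam p.2 i}
      ≃ ({z : Fin ℓ → ℂ // ∑ i, z i ^ 2 = 1} × (Fin ((ℓ - 1) * r) → ℂ))) := by
  classical
  obtain ⟨c, hc⟩ := IsAlgClosed.exists_pow_nat_eq (2 * ζ (Fin.last r)) (n := 2) (by norm_num)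
  have hc0 : c ≠ 0 := by
    rintro rfl
    apply hζ
    simpa using hc.symm
  have hsph : ∀ z : Fin ℓ → ℂ, ∑ i, z i ^ 2 = dotProduct z z := by
    intro z
    simp [dotProduct, sq]
  choose e he using fun z : {z : Fin ℓ → ℂ // ∑ i, z i ^ 2 = 1} =>
    exists_adapted_equiv ℓ z.1 (by rw [← hsph, z.2])
  have E : (Fin r → Fin (ℓ - 1) → ℂ) ≃ (Fin ((ℓ - 1) * r) → ℂ) :=
    ((Equiv.curry _ _ _).symm.trans
      (Equiv.arrowCongr ((Equiv.prodComm _ _).trans finProdFinEquiv) (Equiv.refl ℂ)))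
  refine ⟨(Equiv.ofBijective (β := {z : Fin ℓ → ℂ // ∑ i, z i ^ 2 = 1} × (Fin r → Fin (ℓ - 1) → ℂ))
    (fun lam => 
      let z : {z : Fin ℓ → ℂ // ∑ i, z i ^ 2 = 1} := ⟨c⁻¹ • lam.1 (Fin.last r), by
        rw [hsph, smul_dotProduct, dotProduct_smul, ((fiber_iff ζ hζ lam.1).1 lam.2).1, ← hc]
        simp only [smul_eq_mul]
        field_simp⟩
      (z, fun k => (e z (lam.1 k.castSucc)).2)) ?_).trans
    (Equiv.prodCongr (Equiv.refl _) E)⟩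
  rw [Function.bijective_iff_existsUnique]
  rintro ⟨z, w⟩
  obtain ⟨x, hx, hu⟩ := triangular_existsUnique (0 : Fin ℓ → ℂ) r
    (fun k x => (e z).symm (c⁻¹ * fiberRhs ζ k x, w k))
    (fun k x y h => by simp only [fiberRhs_congr ζ k x y h])
  have hzz : dotProduct z.1 z.1 = 1 := by rw [← hsph, z.2]
  have hx' : ∀ k, e z (x k) = (c⁻¹ * fiberRhs ζ k x, w k) := fun k => by
    rw [hx k, Equiv.apply_symm_apply]
  have hlam : (Fin.snoc x (c • z.1) : Fin (r + 1) → Fin ℓ → ℂ) (Fin.last r) = c • z.1 := by simp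
  have hlam' : ∀ k : Fin r,
      (Fin.snoc x (c • z.1) : Fin (r + 1) → Fin ℓ → ℂ) k.castSucc = x k := by simp
  refine ⟨⟨Fin.snoc x (c • z.1), (fiber_iff ζ hζ _).2 ⟨?_, fun k => ?_⟩⟩, ?_, ?_⟩
  · rw [hlam, smul_dotProduct, dotProduct_smul, hzz, ← hc]
    simp [sq]
  · simp only [hlam, hlam', smul_dotProduct]
    rw [← he, hx']
    simp only [smul_eq_mul]
    field_simp
  · have hz : ∀ h, (⟨c⁻¹ • (Fin.snoc x (c • z.1) : Fin (r + 1) → Fin ℓ → ℂ) (Fin.last r), h⟩ :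
        {z : Fin ℓ → ℂ // ∑ i, z i ^ 2 = 1}) = z := by
      intro h
      apply Subtype.ext
      simp only [hlam]
      rw [smul_smul, inv_mul_cancel₀ hc0, one_smul]
    simp only [hz, hlam', hx']
  · rintro ⟨lam, hl⟩ h
    obtain ⟨h1, h2⟩ := (fiber_iff ζ hζ lam).1 hl
    simp only [Prod.mk.injEq] at h
    obtain ⟨ha, hb⟩ := h
    rw [ha] at hb
    have ha' : lam (Fin.last r) = c • z.1 := by
      rw [← ha, smul_smul, mul_inv_cancel₀ hc0, one_smul]
    have hxx : (fun j : Fin r => lam j.castSucc) = x := by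
      apply hu
      intro k
      rw [Equiv.eq_symm_apply]
      ext1
      · rw [he, ← h2 k, ha', smul_dotProduct, smul_eq_mul]
        field_simp
      · exact congrFun hb k
    apply Subtype.ext
    funext j
    refine Fin.lastCases ?_ (fun k => ?_) j
    · simp only [hlam, ha']
    · exact (congrFun hxx k).trans (hlam' k).symm
end

section
/- Let ℓ ≥ 1 and let r ≥ 1. For v, w ∈ ℂ^ℓ write (v,w) = Σ_{i=1}^ℓ v_i·w_i for the standard symmetric bilinear form, and let S^{ℓ−1}_ℂ = {z ∈ ℂ^ℓ : z_1² + z_2² + ⋯ + z_ℓ² = 1}. Fix (ζ_{r+1}, …, ζ_{2r}) ∈ ℂ^{r−1} × ℂ^× with ζ_{2r} ≠ 0. Then the set of tuples (μ_0, μ_1, …, μ_{r−1}) ∈ (ℂ^ℓ)^{r−1} × (ℂ^ℓ ∖ {0}) satisfying ζ_i = ½·Σ_{0 ≤ k,l ≤ r−1, k+l = i−2} (μ_k, μ_l) for all i = r+1, …, 2r is in bijection with S^{ℓ−1}_ℂ × ℂ^{(ℓ−1)·(r−1)}. -/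
open Finset



lemma hyperplane_equiv (m : ℕ) (v : Fin (m+1) → ℂ) (hv : v ≠ 0) (d : ℂ) :
    Nonempty ({w : Fin (m+1) → ℂ // ∑ i, w i * v i = d} ≃ (Fin m → ℂ)) := by
  obtain ⟨i0, hi⟩ := Function.ne_iff.mp hv
  have hi : v i0 ≠ 0 := hi
  refine ⟨⟨fun w j => w.1 (i0.succAbove j),
    fun u => ⟨i0.insertNth ((d - ∑ j, u j * v (i0.succAbove j)) / v i0) u, ?_⟩, ?_, ?_⟩⟩
  · rw [Fin.sum_univ_succAbove _ i0]
    simp only [Fin.insertNth_apply_same, Fin.insertNth_apply_succAbove]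
    field_simp
    ring
  · rintro ⟨w, hw⟩
    apply Subtype.ext
    funext j
    rw [Fin.sum_univ_succAbove _ i0] at hw
    refine Fin.succAboveCases i0 ?_ (fun j => ?_) j
    · simp only [Fin.insertNth_apply_same]
      rw [← hw]
      field_simp
      ring
    · simp only [Fin.insertNth_apply_succAbove]
  · intro u
    funext j
    simp only [Fin.insertNth_apply_succAbove]

/-- The fiber equations, with an iterated sum. -/
def FibEq (m n : ℕ) (ζ : Fin (n+1) → ℂ) (mu : Fin (n+1) → Fin (m+1) → ℂ) : Prop :=
  mu (Fin.last n) ≠ 0 ∧ ∀ k : Fin (n+1), ζ k = (1/2 : ℂ) * ∑ a : Fin (n+1), ∑ b : Fin (n+1),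
    if (a : ℕ) + (b : ℕ) = n + (k : ℕ) then ∑ i, mu a i * mu b i else 0

/-- The part of the lowest equation not involving the first vector. -/
noncomputable def restTerm (m n : ℕ) (mu : Fin (n+1) → Fin (m+1) → ℂ) : ℂ :=
  ∑ a : Fin (n+1), ∑ b : Fin (n+1),
    if (a : ℕ) + 1 + ((b : ℕ) + 1) = n + 1 then ∑ i, mu a i * mu b i else 0

lemma fibEq_cons (m n : ℕ) (ζ : Fin (n+2) → ℂ) (w : Fin (m+1) → ℂ)
    (mu : Fin (n+1) → Fin (m+1) → ℂ) :
    FibEq m (n+1) ζ (Fin.cons w mu) ↔ FibEq m n (fun k => ζ k.succ) mu ∧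
      ∑ i, w i * mu (Fin.last n) i = ζ 0 - restTerm m n mu / 2 := by
  unfold FibEq
  rw [Fin.forall_fin_succ, ← Fin.succ_last, Fin.cons_succ]
  have h0 : ∑ a : Fin (n+1+1), ∑ b : Fin (n+1+1),
      (if (a : ℕ) + (b : ℕ) = n + 1 + ((0 : Fin (n+1+1)) : ℕ) then
        ∑ i, (Fin.cons w mu : Fin (n+1+1) → Fin (m+1) → ℂ) a i *
          (Fin.cons w mu : Fin (n+1+1) → Fin (m+1) → ℂ) b i else 0)
      = 2 * ∑ i, w i * mu (Fin.last n) i + restTerm m n mu := by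
    have e : ∀ x : Fin (n+1), ((x : ℕ) = n) ↔ x = Fin.last n := by
      intro x; rw [Fin.ext_iff]; simp
    have hc : ∑ i, mu (Fin.last n) i * w i = ∑ i, w i * mu (Fin.last n) i :=
      Finset.sum_congr rfl fun i _ => mul_comm _ _
    rw [Fin.sum_univ_succ, Fin.sum_univ_succ]
    simp only [Fin.sum_univ_succ (n := n+1), Fin.cons_zero, Fin.cons_succ, Fin.val_succ, Fin.val_zero,
      Finset.sum_add_distrib, restTerm, add_zero, zero_add, Nat.add_right_cancel_iff, e,
      Finset.sum_ite_eq', Finset.mem_univ, if_true, hc]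
    simp only [(Nat.succ_ne_zero n).symm, Nat.succ_eq_add_one, if_false] at *
    ring
  have hs : ∀ k : Fin (n+1), ∑ a : Fin (n+1+1), ∑ b : Fin (n+1+1),
      (if (a : ℕ) + (b : ℕ) = n + 1 + (k.succ : ℕ) then
        ∑ i, (Fin.cons w mu : Fin (n+1+1) → Fin (m+1) → ℂ) a i *
          (Fin.cons w mu : Fin (n+1+1) → Fin (m+1) → ℂ) b i else 0)
      = ∑ a : Fin (n+1), ∑ b : Fin (n+1),
        if (a : ℕ) + (b : ℕ) = n + (k : ℕ) then ∑ i, mu a i * mu b i else 0 := by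
    intro k
    rw [Fin.sum_univ_succ, Finset.sum_eq_zero, zero_add]
    · refine Finset.sum_congr rfl fun a _ => ?_
      rw [Fin.sum_univ_succ, if_neg, zero_add]
      · refine Finset.sum_congr rfl fun b _ => ?_
        simp only [Fin.cons_succ, Fin.val_succ]
        refine if_congr ?_ rfl rfl
        omega
      · simp only [Fin.val_succ, Fin.val_zero]; omega
    · intro b _
      rw [if_neg]
      simp only [Fin.val_succ, Fin.val_zero]; omega
  rw [h0]
  simp only [hs]
  constructor
  · rintro ⟨h1, h2, h3⟩
    exact ⟨⟨h1, h3⟩, by rw [h2]; ring⟩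
  · rintro ⟨⟨h1, h3⟩, h2⟩
    exact ⟨h1, by rw [h2]; ring, h3⟩

lemma fib_step (m n : ℕ) (ζ : Fin (n+2) → ℂ) :
    Nonempty ({mu // FibEq m (n+1) ζ mu} ≃
      {mu // FibEq m n (fun k => ζ k.succ) mu} × (Fin m → ℂ)) := by
  have H : ∀ mu : {mu // FibEq m n (fun k => ζ k.succ) mu},
      Nonempty ({w : Fin (m+1) → ℂ // ∑ i, w i * mu.1 (Fin.last n) i
        = ζ 0 - restTerm m n mu.1 / 2} ≃ (Fin m → ℂ)) :=
    fun mu => hyperplane_equiv m _ mu.2.1 _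
  let E := fun mu => (H mu).some
  let e1 : {mu // FibEq m (n+1) ζ mu} ≃
      Σ mu : {mu // FibEq m n (fun k => ζ k.succ) mu},
        {w : Fin (m+1) → ℂ // ∑ i, w i * mu.1 (Fin.last n) i
        = ζ 0 - restTerm m n mu.1 / 2} :=
    { toFun := fun mu =>
        have h := (fibEq_cons m n ζ (mu.1 0) (Fin.tail mu.1)).mp
          (by rw [Fin.cons_self_tail]; exact mu.2)
        ⟨⟨Fin.tail mu.1, h.1⟩, ⟨mu.1 0, h.2⟩⟩
      invFun := fun x => ⟨Fin.cons x.2.1 x.1.1, (fibEq_cons m n ζ _ _).mpr ⟨x.1.2, x.2.2⟩⟩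
      left_inv := fun mu => Subtype.ext (Fin.cons_self_tail _)
      right_inv := fun x => rfl }
  exact ⟨e1.trans ((Equiv.sigmaCongrRight E).trans (Equiv.sigmaEquivProd _ _))⟩

lemma fib_base (m : ℕ) (ζ : Fin 1 → ℂ) (hζ : ζ 0 ≠ 0) :
    Nonempty ({mu // FibEq m 0 ζ mu} ≃ {z : Fin (m+1) → ℂ // ∑ i, z i ^ 2 = 1}) := by
  obtain ⟨c, hc⟩ := IsAlgClosed.exists_pow_nat_eq (2 * ζ 0) (n := 2) (by norm_num)
  have hc0 : c ≠ 0 := by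
    rintro rfl
    apply hζ
    simpa using hc.symm
  have key : ∀ mu : Fin 1 → Fin (m+1) → ℂ, FibEq m 0 ζ mu ↔ ∑ i, mu 0 i ^ 2 = c ^ 2 := by
    intro mu
    have : FibEq m 0 ζ mu ↔ mu 0 ≠ 0 ∧ ζ 0 = (1/2 : ℂ) * ∑ i, mu 0 i ^ 2 := by
      simp [FibEq, pow_two]
    rw [this, hc]
    constructor
    · rintro ⟨_, h⟩
      rw [h]; ring
    · intro h
      refine ⟨?_, by rw [h]; ring⟩
      intro h0
      apply hζ
      simpa [h0] using h.symm
  refine ⟨⟨fun mu => ⟨fun i => mu.1 0 i / c, ?_⟩, fun z => ⟨fun _ i => c * z.1 i, ?_⟩, ?_, ?_⟩⟩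
  · have := (key _).mp mu.2
    simp only [div_pow]
    rw [← Finset.sum_div, this]
    field_simp
  · rw [key]
    simp only [mul_pow]
    rw [← Finset.mul_sum, z.2, mul_one]
  · intro mu
    apply Subtype.ext
    funext j i
    have hj : j = 0 := Subsingleton.elim (α := Fin 1) j 0
    subst hj
    field_simp
  · intro z
    apply Subtype.ext
    funext i
    field_simp

lemma fib_main (m n : ℕ) (ζ : Fin (n+1) → ℂ) (hζ : ζ (Fin.last n) ≠ 0) :
    Nonempty ({mu // FibEq m n ζ mu} ≃
      {z : Fin (m+1) → ℂ // ∑ i, z i ^ 2 = 1} × (Fin (m * n) → ℂ)) := by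
  induction n with
  | zero =>
    obtain ⟨e⟩ := fib_base m ζ hζ
    haveI : Unique (Fin (m * 0) → ℂ) := inferInstanceAs (Unique (Fin 0 → ℂ))
    exact ⟨e.trans (Equiv.prodUnique _ _).symm⟩
  | succ n ih =>
    obtain ⟨e⟩ := fib_step m n ζ
    obtain ⟨f⟩ := ih (fun k => ζ k.succ) hζ
    exact ⟨e.trans (((Equiv.prodCongr f (Equiv.refl _)).trans (Equiv.prodAssoc _ _ _)).trans
      (Equiv.prodCongr (Equiv.refl _) (Fin.appendEquiv (m * n) m)))⟩

/-- The fiber of the twisted Whittaker-type map `Ψ` over a fixed type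
`ζ = (ζ_{r+1}, …, ζ_{2r}) ∈ ℂ^{r-1} × ℂ^×` is in bijection with
`S^{ℓ-1}_ℂ × ℂ^{(ℓ-1)·(r-1)}`, where `S^{ℓ-1}_ℂ = {z ∈ ℂ^ℓ : z_1² + ⋯ + z_ℓ² = 1}`.
Here `mu : Fin r → Fin ℓ → ℂ` encodes `(μ_0, …, μ_{r-1})` (with `μ_k = λ_{k+1/2}`),
`ζ : Fin r → ℂ` encodes `(ζ_{r+1}, …, ζ_{2r})` (so `ζ_{2r} = ζ ⟨r-1,_⟩ ≠ 0`), and the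
fiber condition is `ζ_{r+1+k'} = ½ ∑_{0 ≤ a,b ≤ r-1, a+b = (r+1+k')-2} (μ_a, μ_b)`
together with `μ_{r-1} ≠ 0`. -/
theorem twistedWhittakerTypeMap_fiber_equiv (ℓ r : ℕ) (hℓ : 1 ≤ ℓ) (hr : 1 ≤ r)
    (ζ : Fin r → ℂ) (hζ : ζ ⟨r - 1, by omega⟩ ≠ 0) :
    Nonempty (
      {mu : Fin r → Fin ℓ → ℂ // mu ⟨r - 1, by omega⟩ ≠ 0 ∧
        ∀ k : Fin r,
          ζ k = (1 / 2 : ℂ) * ∑ p ∈ univ.filter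
              (fun p : Fin r × Fin r => (p.1 : ℕ) + (p.2 : ℕ) = (r - 1) + (k : ℕ)),
              ∑ i, mu p.1 i * mu p.2 i}
      ≃ ({z : Fin ℓ → ℂ // ∑ i, z i ^ 2 = 1} × (Fin ((ℓ - 1) * (r - 1)) → ℂ))) := by
  obtain ⟨m, rfl⟩ : ∃ m, ℓ = m + 1 := ⟨ℓ - 1, by omega⟩
  obtain ⟨n, rfl⟩ : ∃ n, r = n + 1 := ⟨r - 1, by omega⟩
  obtain ⟨e⟩ := fib_main m n ζ hζ
  refine ⟨(Equiv.subtypeEquivRight fun mu => ?_).trans e⟩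
  unfold FibEq
  simp only [Finset.sum_filter, ← Finset.univ_product_univ, Finset.sum_product]
  exact Iff.rfl
end
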